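/- Consider a connected oriented graph on n nodes (n ≥ 2) and m arcs with oriented incidence matrix 𝔍, set μ = m − n + 1, and let B be a real μ×m matrix with 𝔍·Bᵀ = 0 and rank B = μ. Let f ∈ ℝ^n, let xₚ ∈ ℝ^m satisfy 𝔍·xₚ = f, let φ_j : ℝ → ℝ for each arc j, and let 𝖻, 𝖼 ∈ ℝ^m. Then the set of cost values attained by the minimum cost flow problem equals the set of cost values attained by the reduced problem: { Σ_{j=1}^{m} φ_j(x_j) | x ∈ ℝ^m, 𝔍·x = f, 𝖻_j ≤ x_j ≤ 𝖼_j for all j } = { Σ_{j=1}^{m} φ_j((Bᵀ·z)_j + (xₚ)_j) | z ∈ ℝ^μ, 𝖻_j ≤ (Bᵀ·z)_j + (xₚ)_j ≤ 𝖼_j for all j }. -/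

import Mathlib

/-- The oriented incidence matrix of an oriented graph given by `tail, head`. -/
def incMat (n m : ℕ) (tail head : Fin m → Fin n) : Matrix (Fin n) (Fin m) ℝ :=
  Matrix.of fun i j => if i = tail j then 1 else if i = head j then -1 else 0

/-- The oriented graph is connected: every pair of nodes is related by the
reflexive–transitive closure of "there is an arc between them". -/
def GraphConnected (n m : ℕ) (tail head : Fin m → Fin n) : Prop :=
  ∀ a b : Fin n, Relation.ReflTransGen
    (fun p q => ∃ j : Fin m, (tail j = p ∧ head j = q) ∨ (tail j = q ∧ head j = p)) a b

lemma incMat_transpose_mulVec {n m : ℕ} {tail head : Fin m → Fin n} {j : Fin m}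
    (hj : tail j ≠ head j) (y : Fin n → ℝ) :
    (incMat n m tail head).transpose.mulVec y j = y (tail j) - y (head j) := by
  have h : ∀ i, (incMat n m tail head).transpose j i * y i =
      (if i = tail j then y i else 0) - (if i = head j then y i else 0) := by
    intro i
    simp only [incMat, Matrix.transpose_apply, Matrix.of_apply]
    split_ifs <;> simp_all
  simp only [Matrix.mulVec, dotProduct, h, Finset.sum_sub_distrib]
  simp

lemma GraphConnected.eq_of_incMat_transpose_mulVec_eq_zero {n m : ℕ} {tail head : Fin m → Fin n}
    (hconn : GraphConnected n m tail head) (hth : ∀ j, tail j ≠ head j) {y : Fin n → ℝ}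
    (hy : (incMat n m tail head).transpose.mulVec y = 0) (a b : Fin n) : y a = y b := by
  have harc : ∀ j, y (tail j) = y (head j) := fun j => by
    rw [← sub_eq_zero, ← incMat_transpose_mulVec (hth j), hy, Pi.zero_apply]
  induction hconn a b with
  | refl => rfl
  | tail _ h ih =>
    obtain ⟨j, ⟨rfl, rfl⟩ | ⟨rfl, rfl⟩⟩ := h
    · exact ih.trans (harc j)
    · exact ih.trans (harc j).symm

lemma GraphConnected.le_rank_incMat_add_one {n m : ℕ} {tail head : Fin m → Fin n}
    (hconn : GraphConnected n m tail head) (hth : ∀ j, tail j ≠ head j) :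
    n ≤ (incMat n m tail head).rank + 1 := by
  have hker : Module.finrank ℝ
      (LinearMap.ker (incMat n m tail head).transpose.mulVecLin) ≤ 1 := by
    have hle : LinearMap.ker (incMat n m tail head).transpose.mulVecLin ≤
        Submodule.span ℝ {(1 : Fin n → ℝ)} := by
      intro y hy
      rw [LinearMap.mem_ker, Matrix.mulVecLin_apply] at hy
      rw [Submodule.mem_span_singleton]
      rcases isEmpty_or_nonempty (Fin n) with h | ⟨⟨a⟩⟩
      · exact ⟨0, Subsingleton.elim _ _⟩
      · refine ⟨y a, funext fun b => ?_⟩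
        simpa using hconn.eq_of_incMat_transpose_mulVec_eq_zero hth hy a b
    exact (Submodule.finrank_mono hle).trans
      ((finrank_span_le_card _).trans (by simp))
  have hrn := (incMat n m tail head).transpose.mulVecLin.finrank_range_add_finrank_ker
  rw [Module.finrank_fin_fun] at hrn
  rw [← Matrix.rank_transpose, Matrix.rank]
  omega

/-- The flows that vanish at every node are exactly the combinations of the rows of a cycle basis
matrix. -/
lemma GraphConnected.range_transpose_eq_ker_incMat {n m μ : ℕ} {tail head : Fin m → Fin n}
    (hconn : GraphConnected n m tail head) (hth : ∀ j, tail j ≠ head j)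
    (hμ : m - n + 1 ≤ μ) {B : Matrix (Fin μ) (Fin m) ℝ}
    (hB : incMat n m tail head * B.transpose = 0) (hrank : B.rank = μ) :
    LinearMap.range B.transpose.mulVecLin = LinearMap.ker (incMat n m tail head).mulVecLin := by
  refine Submodule.eq_of_le_of_finrank_le ?_ ?_
  · rintro _ ⟨z, rfl⟩
    rw [LinearMap.mem_ker, Matrix.mulVecLin_apply, Matrix.mulVecLin_apply, Matrix.mulVec_mulVec, hB,
      Matrix.zero_mulVec]
  · have hrn := (incMat n m tail head).mulVecLin.finrank_range_add_finrank_ker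
    have hle := hconn.le_rank_incMat_add_one hth
    rw [← Matrix.rank_transpose, Matrix.rank] at hrank
    rw [Matrix.rank] at hle
    rw [Module.finrank_fin_fun] at hrn
    omega

/-- the set of cost values attained by the minimum cost flow problem
equals the set of cost values attained by the reduced (cycle-basis) problem. -/
theorem min_cost_flow_cost_values_eq
    (n m : ℕ) (hn : 2 ≤ n) (hm : 1 ≤ m)
    (tail head : Fin m → Fin n) (hth : ∀ j : Fin m, tail j ≠ head j)
    (hconn : GraphConnected n m tail head)
    (μ : ℕ) (hμ : μ = m - n + 1)
    (B : Matrix (Fin μ) (Fin m) ℝ)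
    (hB : incMat n m tail head * B.transpose = 0)
    (hrank : B.rank = μ)
    (f : Fin n → ℝ) (xp : Fin m → ℝ)
    (hxp : (incMat n m tail head).mulVec xp = f)
    (φ : Fin m → ℝ → ℝ) (bb cc : Fin m → ℝ) :
    {c : ℝ | ∃ x : Fin m → ℝ,
        (incMat n m tail head).mulVec x = f ∧
        (∀ j : Fin m, bb j ≤ x j ∧ x j ≤ cc j) ∧
        c = ∑ j : Fin m, φ j (x j)} =
    {c : ℝ | ∃ z : Fin μ → ℝ,
        (∀ j : Fin m, bb j ≤ B.transpose.mulVec z j + xp j ∧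
          B.transpose.mulVec z j + xp j ≤ cc j) ∧
        c = ∑ j : Fin m, φ j (B.transpose.mulVec z j + xp j)} := by
  have hrange := hconn.range_transpose_eq_ker_incMat hth hμ.ge hB hrank
  ext c
  constructor
  · rintro ⟨x, hx, hbd, rfl⟩
    have hmem : x - xp ∈ LinearMap.range B.transpose.mulVecLin := by
      rw [hrange, LinearMap.mem_ker, Matrix.mulVecLin_apply, Matrix.mulVec_sub, hx, hxp, sub_self]
    obtain ⟨z, hz⟩ := hmem
    have hzx : ∀ j, B.transpose.mulVec z j + xp j = x j := fun j => by
      rw [← Matrix.mulVecLin_apply, hz, Pi.sub_apply, sub_add_cancel]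
    exact ⟨z, by simpa only [hzx] using hbd, by simp only [hzx]⟩
  · rintro ⟨z, hbd, rfl⟩
    refine ⟨B.transpose.mulVec z + xp, ?_, hbd, rfl⟩
    rw [Matrix.mulVec_add, Matrix.mulVec_mulVec, hB, Matrix.zero_mulVec, zero_add, hxp]
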